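/- Let A ∈ M_k ⊗ M_m be a PPT matrix with Hermitian Schmidt decomposition A = Σ_{i=1}^n γ_i ⊗ δ_i (all coefficients 1). Then A has a unique Hermitian Schmidt decomposition A = Σ_{i=1}^n γ_i' ⊗ δ_i' in which all γ_i' and δ_i' are positive semidefinite. -/

import Mathlib

open Matrix Kronecker ComplexOrder

/-- The partial transpose (transpose on the first factor), defined entrywise. -/
noncomputable def partialTranspose {k m : ℕ}
    (A : Matrix (Fin k × Fin m) (Fin k × Fin m) ℂ) :
    Matrix (Fin k × Fin m) (Fin k × Fin m) ℂ :=
  Matrix.of fun p q => A (q.1, p.2) (p.1, q.2)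


set_option linter.unusedSectionVars false

section PositiveSemidefinite

variable {ι : Type*} [Fintype ι] [DecidableEq ι]

/-- Functional calculus of a Hermitian matrix in a fixed eigenbasis. -/
lemma Matrix.IsHermitian.exists_diagonal_calculus {Y : Matrix ι ι ℂ} (hY : Y.IsHermitian) :
    ∃ (F : (ι → ℝ) → Matrix ι ι ℂ) (d : ι → ℝ), F d = Y ∧
      (∀ f g, F f * F g = F (f * g)) ∧ (∀ f g, F f - F g = F (f - g)) ∧
      (∀ f, 0 ≤ f → (F f).PosSemidef) := by
  set U : Matrix ι ι ℂ := hY.eigenvectorUnitary.1 with hU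
  have hUU : Uᴴ * U = 1 := by
    simpa [star_eq_conjTranspose] using Unitary.coe_star_mul_self hY.eigenvectorUnitary
  refine ⟨fun f => U * diagonal (fun i => (f i : ℂ)) * Uᴴ, hY.eigenvalues, ?_, ?_, ?_, ?_⟩
  · conv_rhs => rw [hY.spectral_theorem]
    rfl
  · intro f g
    calc _ = U * diagonal (fun i => (f i : ℂ)) * (Uᴴ * U) * diagonal (fun i => (g i : ℂ)) * Uᴴ := by
          simp only [Matrix.mul_assoc]
      _ = _ := by
          rw [hUU, Matrix.mul_one, Matrix.mul_assoc U, diagonal_mul_diagonal]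
          simp
  · intro f g
    rw [← Matrix.sub_mul, ← Matrix.mul_sub, diagonal_sub]
    simp
  · intro f hf
    refine PosSemidef.mul_mul_conjTranspose_same (PosSemidef.diagonal fun i => ?_) U
    simpa using hf i

lemma Matrix.IsHermitian.exists_posPart_negPart {Y : Matrix ι ι ℂ} (hY : Y.IsHermitian) :
    ∃ G H : Matrix ι ι ℂ, (G * Y).PosSemidef ∧ (H * Y).PosSemidef ∧
      Y = G * Y - H * Y ∧ G * Y * (H * Y) = 0 := by
  obtain ⟨F, d, hd, hmul, hsub, hpos⟩ := hY.exists_diagonal_calculus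
  have h0 : F 0 = 0 := by simpa using (hsub 0 0).symm
  refine ⟨F fun i => if 0 < d i then 1 else 0, F fun i => if d i < 0 then -1 else 0, ?_⟩
  nth_rw 1 2 3 4 5 6 7 [← hd]
  simp only [hmul, hsub]
  refine ⟨hpos _ fun i => ?_, hpos _ fun i => ?_, congrArg F (funext fun i => ?_), ?_⟩
  · simp only [Pi.zero_apply, Pi.mul_apply]
    split_ifs <;> linarith
  · simp only [Pi.zero_apply, Pi.mul_apply]
    split_ifs <;> linarith
  · simp only [Pi.sub_apply, Pi.mul_apply]
    rcases lt_trichotomy (d i) 0 with h | h | h <;> simp [h, h.not_gt]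
  · rw [← h0]
    refine congrArg F (funext fun i => ?_)
    rcases lt_trichotomy (d i) 0 with h | h | h <;> simp [h, h.not_gt]

/-- `P` is the orthogonal projection onto the range of `X`, and `B` is a pseudo-inverse of `X`. -/
structure IsSupport (X B P : Matrix ι ι ℂ) : Prop where
  left_inv : B * X = P
  right_inv : X * B = P
  isHermitian : P.IsHermitian
  idem : P * P = P
  mul_self : P * X = X
  self_mul : X * P = X

lemma Matrix.IsHermitian.exists_isSupport {X : Matrix ι ι ℂ} (hX : X.IsHermitian) :
    ∃ B P : Matrix ι ι ℂ, IsSupport X B P := by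
  obtain ⟨F, d, rfl, hmul, -, hpos⟩ := hX.exists_diagonal_calculus
  refine ⟨F fun i => (d i)⁻¹, F fun i => if d i = 0 then 0 else 1, ?_, ?_, ?_, ?_, ?_, ?_⟩
  · rw [hmul]
    refine congrArg F (funext fun i => ?_)
    by_cases h : d i = 0 <;> simp [h]
  · rw [hmul]
    refine congrArg F (funext fun i => ?_)
    by_cases h : d i = 0 <;> simp [h]
  · refine (hpos _ fun i => ?_).1
    by_cases h : d i = 0 <;> simp [h]
  all_goals
    rw [hmul]
    refine congrArg F (funext fun i => ?_)
    by_cases h : d i = 0 <;> simp [h]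

lemma IsSupport.posSemidef_one_sub {X B P : Matrix ι ι ℂ} (h : IsSupport X B P) :
    (1 - P).PosSemidef := by
  have := posSemidef_conjTranspose_mul_self (1 - P)
  rwa [conjTranspose_sub, conjTranspose_one, h.isHermitian.eq, Matrix.mul_sub, Matrix.mul_one,
    Matrix.sub_mul, Matrix.one_mul, h.idem, sub_self, sub_zero] at this

lemma IsSupport.transpose {X B P : Matrix ι ι ℂ} (h : IsSupport X B P) :
    IsSupport Xᵀ Bᵀ Pᵀ where
  left_inv := by rw [← transpose_mul, h.right_inv]
  right_inv := by rw [← transpose_mul, h.left_inv]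
  isHermitian := h.isHermitian.transpose
  idem := by rw [← transpose_mul, h.idem]
  mul_self := by rw [← transpose_mul, h.self_mul]
  self_mul := by rw [← transpose_mul, h.mul_self]

lemma Matrix.PosSemidef.exists_eq_conjTranspose_mul_self {M : Matrix ι ι ℂ} (hM : M.PosSemidef) :
    ∃ B : Matrix ι ι ℂ, M = Bᴴ * B := by
  open scoped MatrixOrder in
  exact CStarAlgebra.nonneg_iff_eq_star_mul_self.1 hM.nonneg

lemma Matrix.PosSemidef.trace_mul_nonneg' {M N : Matrix ι ι ℂ} (hM : M.PosSemidef)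
    (hN : N.PosSemidef) : 0 ≤ (M * N).trace := by
  obtain ⟨B, rfl⟩ := hM.exists_eq_conjTranspose_mul_self
  rw [Matrix.mul_assoc, trace_mul_comm]
  exact (hN.mul_mul_conjTranspose_same B).trace_nonneg

lemma Matrix.PosSemidef.mul_eq_zero_of_trace {M N : Matrix ι ι ℂ} (hM : M.PosSemidef)
    (hN : N.PosSemidef) (h : (M * N).trace = 0) : M * N = 0 := by
  obtain ⟨B, rfl⟩ := hM.exists_eq_conjTranspose_mul_self
  obtain ⟨C, rfl⟩ := hN.exists_eq_conjTranspose_mul_self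
  have h1 : ((B * Cᴴ) * (B * Cᴴ)ᴴ).trace = 0 := by
    rw [← h, conjTranspose_mul, conjTranspose_conjTranspose, Matrix.mul_assoc Bᴴ,
      trace_mul_comm Bᴴ]
    simp only [Matrix.mul_assoc]
  rw [trace_mul_conjTranspose_self_eq_zero_iff] at h1
  rw [Matrix.mul_assoc, ← Matrix.mul_assoc B, h1, Matrix.zero_mul, Matrix.mul_zero]

lemma Matrix.IsHermitian.posSemidef_of_trace_mul_nonneg {M : Matrix ι ι ℂ} (hM : M.IsHermitian)
    (h : ∀ N : Matrix ι ι ℂ, N.PosSemidef → 0 ≤ (M * N).trace) : M.PosSemidef := by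
  refine PosSemidef.of_dotProduct_mulVec_nonneg hM fun x => ?_
  have := h _ (posSemidef_vecMulVec_self_star x)
  rwa [mul_vecMulVec, trace_vecMulVec, dotProduct_comm] at this

lemma Matrix.IsHermitian.mul_eq_zero_comm {M N : Matrix ι ι ℂ} (hM : M.IsHermitian)
    (hN : N.IsHermitian) (h : M * N = 0) : N * M = 0 := by
  have := congrArg (fun K : Matrix ι ι ℂ => Kᴴ) h
  rwa [conjTranspose_mul, hM.eq, hN.eq, conjTranspose_zero] at this

end PositiveSemidefinite

section SchmidtMap

variable {a b ι : Type*} [Fintype a] [DecidableEq a] [Fintype b] [DecidableEq b] [Fintype ι]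
  [DecidableEq ι]

/-- Orthonormality with respect to the bilinear trace form. -/
def TraceOrthonormal (γ : ι → Matrix a a ℂ) : Prop :=
  ∀ i j, (γ i * γ j).trace = if i = j then 1 else 0

/-- The map `X ↦ ∑ i, tr (γ i X) δ i` attached to the tensor `∑ i, γ i ⊗ δ i`. -/
noncomputable def schmidtMap (γ : ι → Matrix a a ℂ) (δ : ι → Matrix b b ℂ) :
    Matrix a a ℂ →ₗ[ℂ] Matrix b b ℂ where
  toFun X := ∑ i, (γ i * X).trace • δ i
  map_add' X Y := by simp [Matrix.mul_add, add_smul, Finset.sum_add_distrib]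
  map_smul' c X := by simp [Finset.smul_sum, mul_smul]

variable {γ : ι → Matrix a a ℂ} {δ : ι → Matrix b b ℂ}

lemma schmidtMap_apply (X : Matrix a a ℂ) : schmidtMap γ δ X = ∑ i, (γ i * X).trace • δ i := rfl

lemma schmidtMap_apply_self (hγ : TraceOrthonormal γ) (j : ι) : schmidtMap γ δ (γ j) = δ j := by
  simp [schmidtMap_apply, hγ _ j]

lemma schmidtMap_schmidtMap {c : Type*} [Fintype c] [DecidableEq c] {ε : ι → Matrix c c ℂ}
    (hδ : TraceOrthonormal δ) (X : Matrix a a ℂ) :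
    schmidtMap δ ε (schmidtMap γ δ X) = schmidtMap γ ε X := by
  rw [schmidtMap_apply X, map_sum]
  simp only [map_smul, schmidtMap_apply_self hδ]
  rw [schmidtMap_apply]

lemma trace_schmidtMap_mul (X : Matrix a a ℂ) (Z : Matrix b b ℂ) :
    (schmidtMap γ δ X * Z).trace = ∑ i, (γ i * X).trace * (δ i * Z).trace := by
  simp [schmidtMap_apply, Finset.sum_mul, trace_sum]

lemma trace_mul_schmidtMap (X : Matrix a a ℂ) (Z : Matrix b b ℂ) :
    (X * schmidtMap δ γ Z).trace = (schmidtMap γ δ X * Z).trace := by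
  rw [trace_mul_comm, trace_schmidtMap_mul, trace_schmidtMap_mul]
  exact Finset.sum_congr rfl fun i _ => mul_comm _ _

lemma trace_sum_kronecker_mul (X : Matrix a a ℂ) (Z : Matrix b b ℂ) :
    ((∑ i, γ i ⊗ₖ δ i) * X ⊗ₖ Z).trace = (schmidtMap γ δ X * Z).trace := by
  rw [trace_schmidtMap_mul, Finset.sum_mul, trace_sum]
  exact Finset.sum_congr rfl fun i _ => by rw [← mul_kronecker_mul, trace_kronecker]

lemma isHermitian_schmidtMap (hγ : ∀ i, (γ i).IsHermitian) (hδ : ∀ i, (δ i).IsHermitian)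
    {X : Matrix a a ℂ} (hX : X.IsHermitian) : (schmidtMap γ δ X).IsHermitian := by
  rw [schmidtMap_apply, IsHermitian, conjTranspose_sum]
  refine Finset.sum_congr rfl fun i _ => ?_
  rw [conjTranspose_smul, (hδ i).eq, ← trace_conjTranspose, conjTranspose_mul, hX.eq, (hγ i).eq,
    trace_mul_comm]

lemma posSemidef_schmidtMap (hA : (∑ i, γ i ⊗ₖ δ i).PosSemidef)
    (hγ : ∀ i, (γ i).IsHermitian) (hδ : ∀ i, (δ i).IsHermitian)
    {X : Matrix a a ℂ} (hX : X.PosSemidef) : (schmidtMap γ δ X).PosSemidef := by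
  refine (isHermitian_schmidtMap hγ hδ hX.1).posSemidef_of_trace_mul_nonneg fun Z hZ => ?_
  rw [← trace_sum_kronecker_mul]
  exact hA.trace_mul_nonneg' (hX.kronecker hZ)

lemma posSemidef_schmidtMap_swap (hA : (∑ i, γ i ⊗ₖ δ i).PosSemidef)
    (hγ : ∀ i, (γ i).IsHermitian) (hδ : ∀ i, (δ i).IsHermitian)
    {Z : Matrix b b ℂ} (hZ : Z.PosSemidef) : (schmidtMap δ γ Z).PosSemidef := by
  refine (isHermitian_schmidtMap hδ hγ hZ.1).posSemidef_of_trace_mul_nonneg fun X hX => ?_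
  rw [trace_mul_comm, trace_mul_schmidtMap, ← trace_sum_kronecker_mul]
  exact hA.trace_mul_nonneg' (hX.kronecker hZ)

lemma eq_sum_of_sum_kronecker_eq {M N : ι → Matrix a a ℂ} {F : ι → Matrix b b ℂ}
    (hδ : TraceOrthonormal δ) (h : ∑ i, M i ⊗ₖ δ i = ∑ i, N i ⊗ₖ F i) (j : ι) :
    M j = ∑ i, (F i * δ j).trace • N i := by
  have key : ∀ (R : ι → Matrix a a ℂ) (S : ι → Matrix b b ℂ) (p q : a),
      ∑ r, ∑ s, (∑ i, R i ⊗ₖ S i) (p, r) (q, s) * δ j s r =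
        (∑ i, (S i * δ j).trace • R i) p q := by
    intro R S p q
    simp only [Matrix.sum_apply, kroneckerMap_apply, Matrix.smul_apply, trace, diag_apply,
      Matrix.mul_apply, smul_eq_mul, Finset.sum_mul]
    calc _ = ∑ r, ∑ i, ∑ s, R i p q * S i r s * δ j s r :=
          Finset.sum_congr rfl fun r _ => Finset.sum_comm
      _ = ∑ i, ∑ r, ∑ s, R i p q * S i r s * δ j s r := Finset.sum_comm
      _ = _ := Finset.sum_congr rfl fun i _ => Finset.sum_congr rfl fun r _ =>
          Finset.sum_congr rfl fun s _ => by ring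
  have h1 : M j = ∑ i, (δ i * δ j).trace • M i := by simp [hδ _ j]
  rw [h1]
  ext p q
  rw [← key, ← key, h]

lemma eq_sum_of_sum_kronecker_eq' {M N : ι → Matrix b b ℂ} {F : ι → Matrix a a ℂ}
    (hγ : TraceOrthonormal γ) (h : ∑ i, γ i ⊗ₖ M i = ∑ i, F i ⊗ₖ N i) (j : ι) :
    M j = ∑ i, (F i * γ j).trace • N i := by
  refine eq_sum_of_sum_kronecker_eq hγ ?_ j
  ext p q
  have := congrFun (congrFun h p.swap) q.swap
  simpa [Matrix.sum_apply, kroneckerMap_apply, mul_comm] using this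

lemma mul_support_eq_sum (hA : (∑ i, γ i ⊗ₖ δ i).PosSemidef) (hδ : TraceOrthonormal δ)
    {X B P : Matrix a a ℂ} {D C Q : Matrix b b ℂ} (hX : X.PosSemidef) (hD : D.PosSemidef)
    (hXD : schmidtMap γ δ X = D) (hDX : schmidtMap δ γ D = X)
    (hP : IsSupport X B P) (hQ : IsSupport D C Q) (j : ι) :
    γ j * P = ∑ i, (δ i * Q * δ j).trace • γ i := by
  have h1 : (∑ i, γ i ⊗ₖ δ i) * P ⊗ₖ (1 - Q) = 0 := by
    have h : (∑ i, γ i ⊗ₖ δ i) * X ⊗ₖ (1 - Q) = 0 := by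
      refine hA.mul_eq_zero_of_trace (hX.kronecker hQ.posSemidef_one_sub) ?_
      rw [trace_sum_kronecker_mul, hXD, Matrix.mul_sub, hQ.self_mul, Matrix.mul_one, sub_self,
        trace_zero]
    rw [← hP.right_inv, ← Matrix.mul_one (1 - Q), mul_kronecker_mul, ← Matrix.mul_assoc, h,
      Matrix.zero_mul]
  have h2 : (∑ i, γ i ⊗ₖ δ i) * (1 - P) ⊗ₖ Q = 0 := by
    have h : (∑ i, γ i ⊗ₖ δ i) * (1 - P) ⊗ₖ D = 0 := by
      refine hA.mul_eq_zero_of_trace (hP.posSemidef_one_sub.kronecker hD) ?_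
      rw [trace_sum_kronecker_mul, ← trace_mul_schmidtMap, hDX, Matrix.sub_mul, hP.mul_self,
        Matrix.one_mul, sub_self, trace_zero]
    rw [← hQ.right_inv, ← Matrix.mul_one (1 - P), mul_kronecker_mul, ← Matrix.mul_assoc, h,
      Matrix.zero_mul]
  have h3 : (∑ i, γ i ⊗ₖ δ i) * P ⊗ₖ 1 = (∑ i, γ i ⊗ₖ δ i) * 1 ⊗ₖ Q := by
    have e1 : P ⊗ₖ (1 : Matrix b b ℂ) = P ⊗ₖ (1 - Q) + P ⊗ₖ Q := by
      rw [← kronecker_add, sub_add_cancel]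
    have e2 : (1 : Matrix a a ℂ) ⊗ₖ Q = (1 - P) ⊗ₖ Q + P ⊗ₖ Q := by
      rw [← add_kronecker, sub_add_cancel]
    rw [e1, e2, Matrix.mul_add, Matrix.mul_add, h1, h2]
  refine eq_sum_of_sum_kronecker_eq (M := fun i => γ i * P) (N := γ) (F := fun i => δ i * Q) hδ ?_ j
  simpa [Finset.sum_mul, ← mul_kronecker_mul] using h3

lemma schmidtMap_posPart (hγo : TraceOrthonormal γ) (hγ : ∀ i, (γ i).IsHermitian)
    (hpos : ∀ X : Matrix a a ℂ, X.PosSemidef → (schmidtMap γ γ X).PosSemidef)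
    {U W : Matrix a a ℂ} (hU : U.PosSemidef) (hW : W.PosSemidef) (hUW : U * W = 0)
    (h : schmidtMap γ γ (U - W) = U - W) :
    schmidtMap γ γ U = U ∧ schmidtMap γ γ W = W := by
  rw [map_sub] at h
  have e1 : schmidtMap γ γ U - U = schmidtMap γ γ W - W := by
    rw [sub_eq_sub_iff_sub_eq_sub]; exact h
  have t1 : (schmidtMap γ γ U * schmidtMap γ γ W).trace = (U * schmidtMap γ γ W).trace := by
    rw [trace_mul_schmidtMap, schmidtMap_schmidtMap hγo, trace_mul_schmidtMap]
  have t2 : (schmidtMap γ γ U * W).trace = (U * schmidtMap γ γ W).trace :=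
    (trace_mul_schmidtMap U W).symm
  have hH : (schmidtMap γ γ U - U).IsHermitian := (isHermitian_schmidtMap hγ hγ hU.1).sub hU.1
  have t3 : ((schmidtMap γ γ U - U)ᴴ * (schmidtMap γ γ U - U)).trace =
      -(U * schmidtMap γ γ W).trace := by
    rw [hH.eq]
    nth_rw 2 [e1]
    simp only [Matrix.sub_mul, Matrix.mul_sub, trace_sub, t1, t2, hUW, trace_zero]
    ring
  have t4 : ((schmidtMap γ γ U - U)ᴴ * (schmidtMap γ γ U - U)).trace = 0 := by
    refine le_antisymm ?_ (posSemidef_conjTranspose_mul_self _).trace_nonneg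
    rw [t3, neg_nonpos]
    exact hU.trace_mul_nonneg' (hpos _ hW)
  rw [trace_conjTranspose_mul_self_eq_zero_iff] at t4
  exact ⟨sub_eq_zero.1 t4, sub_eq_zero.1 (e1 ▸ t4)⟩

lemma schmidtMap_support_mul (hA : (∑ i, γ i ⊗ₖ δ i).PosSemidef)
    (hAt : (∑ i, (γ i)ᵀ ⊗ₖ δ i).PosSemidef)
    (hγ : ∀ i, (γ i).IsHermitian) (hδ : ∀ i, (δ i).IsHermitian)
    (hγo : TraceOrthonormal γ) (hδo : TraceOrthonormal δ)
    {X B P Y : Matrix a a ℂ} (hX : X.PosSemidef) (hXm : schmidtMap γ γ X = X)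
    (hP : IsSupport X B P) (hY : schmidtMap γ γ Y = Y) :
    P * Y = Y * P ∧ schmidtMap γ γ (P * Y) = P * Y := by
  have hD := posSemidef_schmidtMap hA hγ hδ hX
  obtain ⟨C, Q, hQ⟩ := hD.1.exists_isSupport
  have hDX : schmidtMap δ γ (schmidtMap γ δ X) = X := by
    rw [schmidtMap_schmidtMap hδo, hXm]
  have h1 := mul_support_eq_sum hA hδo hX hD rfl hDX hP hQ
  have h2 := mul_support_eq_sum (γ := fun i => (γ i)ᵀ) hAt hδo hX.transpose hD (by
      simp only [schmidtMap_apply, ← transpose_mul, trace_transpose]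
      exact Finset.sum_congr rfl fun i _ => by rw [trace_mul_comm])
    (by
      conv_rhs => rw [← hDX]
      simp only [schmidtMap_apply (γ := δ), transpose_sum, transpose_smul]) hP.transpose hQ
  have h3 : ∀ j, P * γ j = ∑ i, (δ i * Q * δ j).trace • γ i := fun j => by
    have := congrArg (fun K : Matrix a a ℂ => Kᵀ) (h2 j)
    simpa [transpose_sum] using this
  have hc : ∀ j, P * γ j = γ j * P := fun j => (h3 j).trans (h1 j).symm
  have hm : ∀ j, schmidtMap γ γ (P * γ j) = P * γ j := fun j => by
    rw [h3]
    simp [map_sum, schmidtMap_apply_self hγo]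
  rw [← hY, schmidtMap_apply]
  constructor
  · simp [Finset.mul_sum, Finset.sum_mul, hc]
  · simp only [Finset.mul_sum, Matrix.mul_smul, map_sum, map_smul, hm]

/-- A family of nonzero positive semidefinite matrices with pairwise zero products, all fixed by
the projection `schmidtMap γ γ`. -/
structure IsPosFamily (γ : ι → Matrix a a ℂ) {N : ℕ} (X : Fin N → Matrix a a ℂ) : Prop where
  posSemidef : ∀ i, (X i).PosSemidef
  ne_zero : ∀ i, X i ≠ 0
  mul_eq_zero : ∀ i j, i ≠ j → X i * X j = 0
  fixed : ∀ i, schmidtMap γ γ (X i) = X i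

lemma IsPosFamily.cons {N : ℕ} {X : Fin N → Matrix a a ℂ} (hX : IsPosFamily γ X)
    {U : Matrix a a ℂ} (hU : U.PosSemidef) (hU0 : U ≠ 0) (hUf : schmidtMap γ γ U = U)
    (hUX : ∀ i, U * X i = 0) : IsPosFamily γ (Fin.cons U X : Fin (N + 1) → Matrix a a ℂ) where
  posSemidef i := by
    refine Fin.cases ?_ (fun i => ?_) i
    · simpa using hU
    · simpa using hX.posSemidef i
  ne_zero i := by
    refine Fin.cases ?_ (fun i => ?_) i
    · simpa using hU0
    · simpa using hX.ne_zero i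
  mul_eq_zero i j := by
    refine Fin.cases ?_ (fun i => ?_) i <;> refine Fin.cases ?_ (fun j => ?_) j
    · simp
    · intro _; simpa using hUX j
    · simpa using hU.1.mul_eq_zero_comm (hX.posSemidef i).1 (hUX i)
    · simpa using hX.mul_eq_zero i j
  fixed i := by
    refine Fin.cases ?_ (fun i => ?_) i
    · simpa using hUf
    · simpa using hX.fixed i

lemma IsPosFamily.update {N : ℕ} {X : Fin N → Matrix a a ℂ} (hX : IsPosFamily γ X) (i : Fin N)
    {U : Matrix a a ℂ} (hU : U.PosSemidef) (hU0 : U ≠ 0) (hUf : schmidtMap γ γ U = U)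
    (hUX : ∀ j, j ≠ i → U * X j = 0) : IsPosFamily γ (Function.update X i U) where
  posSemidef j := by
    by_cases h : j = i
    · subst h; simpa using hU
    · simpa [h] using hX.posSemidef j
  ne_zero j := by
    by_cases h : j = i
    · subst h; simpa using hU0
    · simpa [h] using hX.ne_zero j
  mul_eq_zero j l hjl := by
    by_cases h : j = i
    · subst h; simpa [hjl.symm] using hUX l hjl.symm
    · by_cases h' : l = i
      · subst h'
        simpa [h] using hU.1.mul_eq_zero_comm (hX.posSemidef j).1 (hUX j h)
      · simpa [h, h'] using hX.mul_eq_zero j l hjl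
  fixed j := by
    by_cases h : j = i
    · subst h; simpa using hUf
    · simpa [h] using hX.fixed j

/-- A nonzero Hermitian matrix in the range of the projection `schmidtMap γ γ`, trace-orthogonal
to a given finite family of Hermitian matrices. -/
lemma exists_fixed_trace_orthogonal {n N : ℕ} {γ : Fin n → Matrix a a ℂ} (hN : N < n)
    (hγo : TraceOrthonormal γ) (hγ : ∀ i, (γ i).IsHermitian)
    {X : Fin N → Matrix a a ℂ} (hX : ∀ i, (X i).IsHermitian) :
    ∃ Y : Matrix a a ℂ, Y.IsHermitian ∧ Y ≠ 0 ∧ schmidtMap γ γ Y = Y ∧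
      ∀ i, (Y * X i).trace = 0 := by
  let M : Matrix (Fin N) (Fin n) ℝ := Matrix.of fun j i => ((γ i * X j).trace).re
  obtain ⟨c, hc, hc0⟩ := (Submodule.ne_bot_iff _).1
    (LinearMap.ker_ne_bot_of_finrank_lt (f := M.mulVecLin) (by simpa using hN))
  have hreal : ∀ i j, (((γ i * X j).trace).re : ℂ) = (γ i * X j).trace := fun i j => by
    rw [← Complex.conj_eq_iff_re, starRingEnd_apply, ← trace_conjTranspose, conjTranspose_mul,
      (hγ i).eq, (hX j).eq, trace_mul_comm]
  refine ⟨∑ i, (c i : ℂ) • γ i, ?_, ?_, ?_, ?_⟩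
  · rw [IsHermitian, conjTranspose_sum]
    exact Finset.sum_congr rfl fun i _ => by rw [conjTranspose_smul, (hγ i).eq]; simp
  · intro h
    refine hc0 (funext fun j => ?_)
    have := congrArg (fun K => (γ j * K).trace) h
    simpa [Finset.mul_sum, trace_sum, hγo j] using this
  · simp [map_sum, schmidtMap_apply_self hγo]
  · intro j
    have h1 : ∑ i, ((γ i * X j).trace).re * c i = 0 := congrFun (LinearMap.mem_ker.1 hc) j
    have h2 : ∑ i, (γ i * X j).trace * (c i : ℂ) = 0 := by
      have := congrArg (fun x : ℝ => (x : ℂ)) h1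
      simpa [hreal] using this
    simpa [Finset.sum_mul, trace_sum, mul_comm] using h2

lemma IsPosFamily.exists_succ {n N : ℕ} {γ : Fin n → Matrix a a ℂ} {δ : Fin n → Matrix b b ℂ}
    (hA : (∑ i, γ i ⊗ₖ δ i).PosSemidef) (hAt : (∑ i, (γ i)ᵀ ⊗ₖ δ i).PosSemidef)
    (hγ : ∀ i, (γ i).IsHermitian) (hδ : ∀ i, (δ i).IsHermitian)
    (hγo : TraceOrthonormal γ) (hδo : TraceOrthonormal δ) (hN : N < n)
    {X : Fin N → Matrix a a ℂ} (hX : IsPosFamily γ X) :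
    ∃ X' : Fin (N + 1) → Matrix a a ℂ, IsPosFamily γ X' := by
  have hpos : ∀ X : Matrix a a ℂ, X.PosSemidef → (schmidtMap γ γ X).PosSemidef := fun X hX => by
    rw [← schmidtMap_schmidtMap hδo]
    exact posSemidef_schmidtMap_swap hA hγ hδ (posSemidef_schmidtMap hA hγ hδ hX)
  obtain ⟨Y, hY, hY0, hYf, hYX⟩ :=
    exists_fixed_trace_orthogonal hN hγo hγ fun i => (hX.posSemidef i).1
  choose B P hP using fun i => (hX.posSemidef i).1.exists_isSupport
  have hPY := fun i => schmidtMap_support_mul hA hAt hγ hδ hγo hδo (hX.posSemidef i)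
    (hX.fixed i) (hP i) hYf
  by_cases hcase : ∀ i, P i * Y = 0
  · have hYX0 : ∀ i, Y * X i = 0 := fun i => by
      rw [← (hP i).mul_self, ← Matrix.mul_assoc, ← (hPY i).1, hcase, Matrix.zero_mul]
    obtain ⟨G, H, hG, hH, hGH, hmul⟩ := hY.exists_posPart_negPart
    obtain ⟨hGf, hHf⟩ := schmidtMap_posPart hγo hγ hpos hG hH hmul (by rw [← hGH, hYf])
    by_cases hG0 : G * Y = 0
    · have hH0 : H * Y ≠ 0 := fun h => hY0 (by rw [hGH, hG0, h, sub_zero])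
      exact ⟨_, hX.cons hH hH0 hHf fun i => by rw [Matrix.mul_assoc, hYX0, Matrix.mul_zero]⟩
    · exact ⟨_, hX.cons hG hG0 hGf fun i => by rw [Matrix.mul_assoc, hYX0, Matrix.mul_zero]⟩
  · push Not at hcase
    obtain ⟨i, hi⟩ := hcase
    obtain ⟨hcomm, hWf⟩ := hPY i
    have hW : (P i * Y).IsHermitian := by
      rw [IsHermitian, conjTranspose_mul, hY.eq, (hP i).isHermitian.eq, hcomm]
    have hWP : P i * Y * P i = P i * Y := by
      rw [Matrix.mul_assoc, ← hcomm, ← Matrix.mul_assoc, (hP i).idem]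
    have hWX : ∀ j, j ≠ i → P i * Y * X j = 0 := fun j hj => by
      rw [hcomm, ← (hP i).left_inv, Matrix.mul_assoc, Matrix.mul_assoc,
        hX.mul_eq_zero i j hj.symm, Matrix.mul_zero, Matrix.mul_zero]
    have htr : (P i * Y * X i).trace = 0 := by
      rw [hcomm, Matrix.mul_assoc, (hP i).mul_self, hYX]
    generalize P i * Y = W at *
    obtain ⟨G, H, hG, hH, hGH, hmul⟩ := hW.exists_posPart_negPart
    obtain ⟨hGf, hHf⟩ := schmidtMap_posPart hγo hγ hpos hG hH hmul (by rw [← hGH, hWf])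
    have hkill : ∀ K : Matrix a a ℂ, (K * W).PosSemidef → (K * W * X i).trace = 0 →
        K * W = 0 := fun K hK ht => by
      have h1 := hK.mul_eq_zero_of_trace (hX.posSemidef i) ht
      rw [← hWP, ← (hP i).right_inv, ← Matrix.mul_assoc, ← Matrix.mul_assoc, h1, Matrix.zero_mul]
    have htGH : (G * W * X i).trace = (H * W * X i).trace := by
      rw [← sub_eq_zero, ← trace_sub, ← Matrix.sub_mul, ← hGH, htr]
    have hG0 : G * W ≠ 0 := fun h => hi <| by
      rw [hGH, h, hkill H hH (by rw [← htGH, h, Matrix.zero_mul, trace_zero]), sub_zero]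
    have hH0 : H * W ≠ 0 := fun h => hi <| by
      rw [hGH, h, hkill G hG (by rw [htGH, h, Matrix.zero_mul, trace_zero]), sub_zero]
    refine ⟨_, (hX.update i hG hG0 hGf fun j hj => by
      rw [Matrix.mul_assoc, hWX j hj, Matrix.mul_zero]).cons hH hH0 hHf fun j => ?_⟩
    by_cases hj : j = i
    · subst hj
      simpa using hG.1.mul_eq_zero_comm hH.1 hmul
    · simp [hj, Matrix.mul_assoc, hWX j hj]

lemma exists_isPosFamily {n : ℕ} {γ : Fin n → Matrix a a ℂ} {δ : Fin n → Matrix b b ℂ}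
    (hA : (∑ i, γ i ⊗ₖ δ i).PosSemidef) (hAt : (∑ i, (γ i)ᵀ ⊗ₖ δ i).PosSemidef)
    (hγ : ∀ i, (γ i).IsHermitian) (hδ : ∀ i, (δ i).IsHermitian)
    (hγo : TraceOrthonormal γ) (hδo : TraceOrthonormal δ) :
    ∀ N ≤ n, ∃ X : Fin N → Matrix a a ℂ, IsPosFamily γ X := by
  intro N
  induction N with
  | zero => exact fun _ => ⟨Fin.elim0, ⟨fun i => i.elim0, fun i => i.elim0, fun i => i.elim0,
      fun i => i.elim0⟩⟩
  | succ N ih =>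
    intro hN
    obtain ⟨X, hX⟩ := ih (by omega)
    exact hX.exists_succ hA hAt hγ hδ hγo hδo hN

/-- Normalization of a family of nonzero, pairwise annihilating positive semidefinite matrices. -/
lemma IsPosFamily.exists_traceOrthonormal {N : ℕ} {X : Fin N → Matrix a a ℂ}
    (hX : IsPosFamily γ X) : ∃ Z : Fin N → Matrix a a ℂ, TraceOrthonormal Z ∧
      (∀ i, (Z i).PosSemidef) ∧ ∀ i, schmidtMap γ γ (Z i) = Z i := by
  have hr : ∀ i, ∃ r : ℝ, 0 < r ∧ (X i * X i).trace = (r : ℂ) := fun i => by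
    have h0 : 0 ≤ (X i * X i).trace := (hX.posSemidef i).trace_mul_nonneg' (hX.posSemidef i)
    obtain ⟨h1, h2⟩ := Complex.le_def.1 h0
    refine ⟨(X i * X i).trace.re, lt_of_le_of_ne h1 fun h => hX.ne_zero i ?_, ?_⟩
    · rw [← trace_conjTranspose_mul_self_eq_zero_iff, (hX.posSemidef i).1.eq]
      exact Complex.ext h.symm h2.symm
    · exact Complex.ext rfl h2.symm
  choose r hr0 hr using hr
  refine ⟨fun i => ((Real.sqrt (r i))⁻¹ : ℂ) • X i, fun i j => ?_, fun i => ?_, fun i => ?_⟩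
  · by_cases hij : i = j
    · subst hij
      have h1 : ((Real.sqrt (r i) : ℝ) : ℂ) * (Real.sqrt (r i) : ℝ) = r i := by
        rw [← Complex.ofReal_mul, Real.mul_self_sqrt (hr0 i).le]
      have h2 : (r i : ℂ) ≠ 0 := by exact_mod_cast (hr0 i).ne'
      simp only [Matrix.smul_mul, Matrix.mul_smul, trace_smul, hr, if_true, smul_eq_mul]
      rw [← mul_assoc, ← mul_inv, h1, inv_mul_cancel₀ h2]
    · simp [hij, hX.mul_eq_zero i j hij]
  · refine (hX.posSemidef i).smul ?_
    rw [← Complex.ofReal_inv]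
    exact_mod_cast inv_nonneg.2 (Real.sqrt_nonneg _)
  · rw [map_smul, hX.fixed]

end SchmidtMap

/-- A complex orthogonal matrix with nonnegative entries is a permutation matrix. -/
lemma exists_perm_of_nonneg_orthogonal {n : ℕ} {d : Fin n → Fin n → ℂ} (h0 : ∀ i j, 0 ≤ d i j)
    (h : ∀ i l, ∑ j, d i j * d l j = if i = l then 1 else 0) :
    ∃ σ : Equiv.Perm (Fin n), ∀ i j, d i j = if j = σ i then 1 else 0 := by
  have hz : ∀ i l j, i ≠ l → d i j * d l j = 0 := fun i l j hil => by
    have := h i l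
    rw [if_neg hil, Finset.sum_eq_zero_iff_of_nonneg fun j _ => mul_nonneg (h0 i j) (h0 l j)] at this
    exact this j (Finset.mem_univ j)
  have hex : ∀ i, ∃ j, d i j ≠ 0 := fun i => by
    by_contra! hc
    simpa [hc] using h i i
  choose s hs using hex
  have hinj : Function.Injective s := fun i l hil => by
    by_contra hne
    exact mul_ne_zero (hs i) (hil ▸ hs l) (hz i l (s i) hne)
  have hbij := Finite.injective_iff_bijective.1 hinj
  have hoff : ∀ i j, j ≠ s i → d i j = 0 := fun i j hj => by
    obtain ⟨l, rfl⟩ := hbij.2 j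
    exact (mul_eq_zero.1 (hz i l (s l) fun e => hj (by rw [e]))).resolve_right (hs l)
  refine ⟨Equiv.ofBijective s hbij, fun i j => ?_⟩
  rw [Equiv.ofBijective_apply]
  split_ifs with hj
  · subst hj
    have h1 := h i i
    rw [if_pos rfl, Finset.sum_eq_single (s i) (fun j _ hj => by rw [hoff i j hj, mul_zero])
      (by simp)] at h1
    rcases mul_self_eq_one_iff.1 h1 with h2 | h2
    · exact h2
    · have h3 := (Complex.le_def.1 (h0 i (s i))).1
      rw [h2] at h3
      norm_num at h3
  · exact hoff i j hj

lemma sum_kronecker_schmidtMap_eq {a b : Type*} [Fintype a] [DecidableEq a] [Fintype b]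
    [DecidableEq b] {n : ℕ} {γ : Fin n → Matrix a a ℂ} {δ : Fin n → Matrix b b ℂ}
    {Z : Fin n → Matrix a a ℂ} (hZ : TraceOrthonormal Z) (hZf : ∀ i, schmidtMap γ γ (Z i) = Z i) :
    ∑ j, Z j ⊗ₖ schmidtMap γ δ (Z j) = ∑ i, γ i ⊗ₖ δ i := by
  let O : Matrix (Fin n) (Fin n) ℂ := Matrix.of fun j i => (γ i * Z j).trace
  have hO : O * Oᵀ = 1 := by
    ext j l
    rw [one_apply, ← hZ j l]
    nth_rw 1 [← hZf j]
    rw [trace_schmidtMap_mul]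
    rfl
  have hO' : Oᵀ * O = 1 := mul_eq_one_comm.1 hO
  have hO'' : ∀ i l, ∑ j, O j i * O j l = if i = l then 1 else 0 := fun i l => by
    rw [← one_apply, ← hO']
    rfl
  calc ∑ j, Z j ⊗ₖ schmidtMap γ δ (Z j)
      = ∑ j, (∑ i, O j i • γ i) ⊗ₖ ∑ l, O j l • δ l :=
        Finset.sum_congr rfl fun j _ => by nth_rw 1 [← hZf j]; rfl
    _ = ∑ j, ∑ i, ∑ l, (O j i * O j l) • γ i ⊗ₖ δ l := Finset.sum_congr rfl fun j _ => by
        ext p q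
        simp only [kroneckerMap_apply, Matrix.sum_apply, Matrix.smul_apply, smul_eq_mul,
          Finset.sum_mul_sum]
        exact Finset.sum_congr rfl fun i _ => Finset.sum_congr rfl fun l _ => by ring
    _ = ∑ i, ∑ l, ∑ j, (O j i * O j l) • γ i ⊗ₖ δ l := by
        rw [Finset.sum_comm]
        exact Finset.sum_congr rfl fun i _ => Finset.sum_comm
    _ = ∑ i, γ i ⊗ₖ δ i := by
        simp only [← Finset.sum_smul, hO'']
        simp

/-- A PPT matrix with Hermitian Schmidt decomposition with all coefficients 1 has a
unique Hermitian Schmidt decomposition with all factors positive semidefinite. -/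
theorem stmt14 {k m n : ℕ} (A : Matrix (Fin k × Fin m) (Fin k × Fin m) ℂ)
    (hA : A.PosSemidef) (hPPT : (partialTranspose A).PosSemidef)
    (γ : Fin n → Matrix (Fin k) (Fin k) ℂ) (δ : Fin n → Matrix (Fin m) (Fin m) ℂ)
    (hγ : ∀ i, (γ i).IsHermitian) (hδ : ∀ i, (δ i).IsHermitian)
    (hoγ : ∀ i j, Matrix.trace (γ i * (γ j)ᴴ) = if i = j then 1 else 0)
    (hoδ : ∀ i j, Matrix.trace (δ i * (δ j)ᴴ) = if i = j then 1 else 0)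
    (hdec : A = ∑ i, γ i ⊗ₖ δ i) :
    ∃ (γ' : Fin n → Matrix (Fin k) (Fin k) ℂ) (δ' : Fin n → Matrix (Fin m) (Fin m) ℂ),
      (∀ i, (γ' i).PosSemidef) ∧ (∀ i, (δ' i).PosSemidef) ∧
      (∀ i j, Matrix.trace (γ' i * (γ' j)ᴴ) = if i = j then 1 else 0) ∧
      (∀ i j, Matrix.trace (δ' i * (δ' j)ᴴ) = if i = j then 1 else 0) ∧
      A = ∑ i, γ' i ⊗ₖ δ' i ∧
      ∀ (γ'' : Fin n → Matrix (Fin k) (Fin k) ℂ) (δ'' : Fin n → Matrix (Fin m) (Fin m) ℂ),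
        (∀ i, (γ'' i).PosSemidef) → (∀ i, (δ'' i).PosSemidef) →
        (∀ i j, Matrix.trace (γ'' i * (γ'' j)ᴴ) = if i = j then 1 else 0) →
        (∀ i j, Matrix.trace (δ'' i * (δ'' j)ᴴ) = if i = j then 1 else 0) →
        A = ∑ i, γ'' i ⊗ₖ δ'' i →
        ∃ σ : Equiv.Perm (Fin n), ∀ i, γ'' i = γ' (σ i) ∧ δ'' i = δ' (σ i) := by
  have hγo : TraceOrthonormal γ := fun i j => by rw [← hoγ i j, (hγ j).eq]
  have hδo : TraceOrthonormal δ := fun i j => by rw [← hoδ i j, (hδ j).eq]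
  have hpt : partialTranspose A = ∑ i, (γ i)ᵀ ⊗ₖ δ i := by
    ext p q
    simp [partialTranspose, hdec, Matrix.sum_apply]
  rw [hpt] at hPPT
  rw [hdec] at hA
  obtain ⟨X, hX⟩ := exists_isPosFamily hA hPPT hγ hδ hγo hδo n le_rfl
  obtain ⟨Z, hZo, hZ, hZf⟩ := hX.exists_traceOrthonormal
  have hW : ∀ i, (schmidtMap γ δ (Z i)).PosSemidef := fun i =>
    posSemidef_schmidtMap hA hγ hδ (hZ i)
  have hWo : TraceOrthonormal fun i => schmidtMap γ δ (Z i) := fun i j => by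
    rw [← trace_mul_schmidtMap, schmidtMap_schmidtMap hδo, hZf]
    exact hZo i j
  have hdec' : A = ∑ i, Z i ⊗ₖ schmidtMap γ δ (Z i) := by
    rw [hdec, sum_kronecker_schmidtMap_eq hZo hZf]
  refine ⟨Z, fun i => schmidtMap γ δ (Z i), hZ, hW, fun i j => ?_, fun i j => ?_, hdec', ?_⟩
  · rw [(hZ j).1.eq, hZo]
  · rw [(hW j).1.eq, hWo]
  intro γ'' δ'' hγ'' hδ'' hoγ'' hoδ'' hdec''
  have hγo'' : TraceOrthonormal γ'' := fun i j => by rw [← hoγ'' i j, (hγ'' j).1.eq]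
  have hδo'' : TraceOrthonormal δ'' := fun i j => by rw [← hoδ'' i j, (hδ'' j).1.eq]
  have e1 := eq_sum_of_sum_kronecker_eq hδo'' (hdec''.symm.trans hdec')
  have e2 := eq_sum_of_sum_kronecker_eq' hγo'' (hdec''.symm.trans hdec')
  obtain ⟨σ, hσ⟩ := exists_perm_of_nonneg_orthogonal
    (d := fun i j => (schmidtMap γ δ (Z j) * δ'' i).trace)
    (fun i j => (hW j).trace_mul_nonneg' (hδ'' i)) (fun i l => by
      rw [← hγo'' i l, e1 i, e1 l]
      simp [Finset.sum_mul, Finset.mul_sum, trace_sum, hZo _ _, mul_comm])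
  have e3 : ∀ i, γ'' i = Z (σ i) := fun i => by
    rw [e1 i]
    simp [hσ i]
  refine ⟨σ, fun i => ⟨e3 i, ?_⟩⟩
  rw [e2 i]
  simp [e3, hZo _ _]
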